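/- arXiv:2212.09336 — 2 statements merged into one kernel-verified Lean document; each statement's English description precedes it below -/
import Mathlib

section
/- The function r ↦ μ(r) + log r is strictly decreasing on (0,1), tends to log 4 as r → 0⁺, and tends to 0 as r → 1⁻; in particular it maps (0,1) onto (0, log 4). -/
/-- Complete elliptic integral of the first kind. -/
noncomputable def ellK (r : ℝ) : ℝ :=
  ∫ x in (0:ℝ)..1, 1 / Real.sqrt ((1 - x ^ 2) * (1 - r ^ 2 * x ^ 2))

/-- The Grötzsch modulus function `μ`. -/
noncomputable def mu (r : ℝ) : ℝ :=
  Real.pi / 2 * ellK (Real.sqrt (1 - r ^ 2)) / ellK r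

open Real Set Filter Topology MeasureTheory

lemma one_sub_sq_mul_sq_pos {c x : ℝ} (hc : c ∈ Icc (0:ℝ) 1) (hx : x ∈ Ioo (0:ℝ) 1) :
    0 < 1 - c ^ 2 * x ^ 2 := by
  have h1 : c ^ 2 ≤ 1 := by nlinarith [hc.1, hc.2]
  have h2 : x ^ 2 < 1 := by nlinarith [hx.1, hx.2]
  nlinarith [sq_nonneg x, sq_nonneg c]

lemma one_sub_sq_pos {x : ℝ} (hx : x ∈ Ioo (0:ℝ) 1) : 0 < 1 - x ^ 2 := by
  nlinarith [hx.1, hx.2]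

lemma sqrt_one_sub_sq_mem {r : ℝ} (hr : r ∈ Ioo (0:ℝ) 1) : √(1 - r ^ 2) ∈ Ioo (0:ℝ) 1 := by
  refine ⟨sqrt_pos.2 (one_sub_sq_pos hr), ?_⟩
  rw [sqrt_lt' one_pos]
  nlinarith [hr.1]

lemma sq_sqrt_one_sub_sq {r : ℝ} (hr : r ∈ Ioo (0:ℝ) 1) : √(1 - r ^ 2) ^ 2 = 1 - r ^ 2 :=
  sq_sqrt (one_sub_sq_pos hr).le

lemma sqrt_one_sub_sqrt_sq {r : ℝ} (hr : r ∈ Ioo (0:ℝ) 1) : √(1 - √(1 - r ^ 2) ^ 2) = r := by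
  rw [sq_sqrt_one_sub_sq hr, sub_sub_cancel, sqrt_sq hr.1.le]

/-! ### Estimates for the complete elliptic integral -/

lemma ellK_eq_setIntegral (r : ℝ) :
    ellK r = ∫ x in Ioo (0:ℝ) 1, 1 / √((1 - x ^ 2) * (1 - r ^ 2 * x ^ 2)) := by
  rw [ellK, intervalIntegral.integral_of_le zero_le_one, integral_Ioc_eq_integral_Ioo]

lemma integrableOn_one_div_sqrt_one_sub_sq :
    IntegrableOn (fun x : ℝ => 1 / √(1 - x ^ 2)) (Ioc 0 1) :=
  intervalIntegral.integrableOn_deriv_of_nonneg continuous_arcsin.continuousOn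
    (fun x hx => hasDerivAt_arcsin (by linarith [hx.1]) hx.2.ne) (fun x _ => by positivity)

lemma setIntegral_one_div_sqrt_one_sub_sq :
    ∫ x in Ioo (0:ℝ) 1, 1 / √(1 - x ^ 2) = π / 2 := by
  rw [← integral_Ioc_eq_integral_Ioo, ← intervalIntegral.integral_of_le zero_le_one,
    intervalIntegral.integral_eq_sub_of_hasDerivAt_of_le zero_le_one
      continuous_arcsin.continuousOn
      (fun x hx => hasDerivAt_arcsin (by linarith [hx.1]) hx.2.ne)
      ((intervalIntegrable_iff_integrableOn_Ioc_of_le zero_le_one).2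
        integrableOn_one_div_sqrt_one_sub_sq)]
  simp

lemma one_div_sqrt_mul_le {c x : ℝ} (hc : c ∈ Ioo (0:ℝ) 1) (hx : x ∈ Ioo (0:ℝ) 1) :
    1 / √((1 - x ^ 2) * (1 - c ^ 2 * x ^ 2)) ≤ 1 / √(1 - c ^ 2) * (1 / √(1 - x ^ 2)) := by
  have hx' := one_sub_sq_pos hx
  have hc' := one_sub_sq_pos hc
  rw [one_div_mul_one_div, ← sqrt_mul hc'.le, mul_comm (1 - c ^ 2)]
  gcongr
  nlinarith [sq_nonneg c]

lemma integrableOn_ellK {c : ℝ} (hc : c ∈ Ioo (0:ℝ) 1) :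
    IntegrableOn (fun x : ℝ => 1 / √((1 - x ^ 2) * (1 - c ^ 2 * x ^ 2))) (Ioo 0 1) := by
  refine Integrable.mono'
    ((integrableOn_one_div_sqrt_one_sub_sq.mono_set Ioo_subset_Ioc_self).const_mul
      (1 / √(1 - c ^ 2))) (Measurable.aestronglyMeasurable (by fun_prop)) ?_
  refine (ae_restrict_iff' measurableSet_Ioo).2 (Eventually.of_forall fun x hx => ?_)
  rw [norm_of_nonneg (by positivity)]
  exact one_div_sqrt_mul_le hc hx

lemma ellK_le {c : ℝ} (hc : c ∈ Ioo (0:ℝ) 1) : ellK c ≤ π / 2 / √(1 - c ^ 2) := by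
  have h := setIntegral_mono_on (integrableOn_ellK hc)
    ((integrableOn_one_div_sqrt_one_sub_sq.mono_set Ioo_subset_Ioc_self).const_mul
      (1 / √(1 - c ^ 2))) measurableSet_Ioo (fun x hx => one_div_sqrt_mul_le hc hx)
  rw [integral_const_mul, setIntegral_one_div_sqrt_one_sub_sq, ← ellK_eq_setIntegral] at h
  exact h.trans_eq (by ring)

lemma pi_div_two_le_ellK {c : ℝ} (hc : c ∈ Ioo (0:ℝ) 1) : π / 2 ≤ ellK c := by
  rw [← setIntegral_one_div_sqrt_one_sub_sq, ellK_eq_setIntegral]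
  refine setIntegral_mono_on (integrableOn_one_div_sqrt_one_sub_sq.mono_set Ioo_subset_Ioc_self)
    (integrableOn_ellK hc) measurableSet_Ioo fun x hx => ?_
  have h1 := one_sub_sq_pos hx
  have h2 := one_sub_sq_mul_sq_pos (Ioo_subset_Icc_self hc) hx
  have := mul_pos h1 h2
  gcongr
  nlinarith [mul_nonneg (sq_nonneg c) (sq_nonneg x)]

lemma ellK_pos {c : ℝ} (hc : c ∈ Ioo (0:ℝ) 1) : 0 < ellK c :=
  lt_of_lt_of_le (by positivity) (pi_div_two_le_ellK hc)

lemma continuousOn_ellK_primitive {c : ℝ} (hc : c ∈ Ioo (0:ℝ) 1) :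
    ContinuousOn (fun x : ℝ => -log (c * √(1 - x ^ 2) + √(1 - c ^ 2 * x ^ 2)) / c)
      (Icc 0 1) := by
  refine ContinuousOn.div_const (ContinuousOn.neg (ContinuousOn.log (by fun_prop) ?_)) _
  intro x hx
  have h : 0 < 1 - c ^ 2 * x ^ 2 := by
    have h1 := one_sub_sq_pos hc
    have h2 : x ^ 2 ≤ 1 := by nlinarith [hx.1, hx.2]
    nlinarith [sq_nonneg c]
  have := sqrt_pos.2 h
  have := mul_nonneg hc.1.le (sqrt_nonneg (1 - x ^ 2))
  linarith

lemma hasDerivAt_ellK_primitive {c x : ℝ} (hc : c ∈ Ioo (0:ℝ) 1) (hx : x ∈ Ioo (0:ℝ) 1) :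
    HasDerivAt (fun x : ℝ => -log (c * √(1 - x ^ 2) + √(1 - c ^ 2 * x ^ 2)) / c)
      (x / √((1 - x ^ 2) * (1 - c ^ 2 * x ^ 2))) x := by
  have h1 := one_sub_sq_pos hx
  have h2 := one_sub_sq_mul_sq_pos (Ioo_subset_Icc_self hc) hx
  have hA := sqrt_pos.2 h1
  have hB := sqrt_pos.2 h2
  have hc0 := hc.1
  have d1 : HasDerivAt (fun x : ℝ => 1 - x ^ 2) (-(2 * x)) x := by
    simpa using (hasDerivAt_pow 2 x).const_sub 1
  have d2 : HasDerivAt (fun x : ℝ => 1 - c ^ 2 * x ^ 2) (-(c ^ 2 * (2 * x))) x := by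
    simpa using ((hasDerivAt_pow 2 x).const_mul (c ^ 2)).const_sub 1
  have d := ((((d1.sqrt h1.ne').const_mul c).add (d2.sqrt h2.ne')).log
    (by simp only [Pi.add_apply]; positivity)).neg.div_const c
  refine d.congr_deriv ?_
  simp only [Pi.add_apply]
  rw [sqrt_mul h1.le]
  field_simp
  ring

lemma integrableOn_mul_ellK {c : ℝ} (hc : c ∈ Ioo (0:ℝ) 1) :
    IntegrableOn (fun x : ℝ => x / √((1 - x ^ 2) * (1 - c ^ 2 * x ^ 2))) (Ioc 0 1) :=
  intervalIntegral.integrableOn_deriv_of_nonneg (continuousOn_ellK_primitive hc)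
    (fun _ hx => hasDerivAt_ellK_primitive hc hx)
    (fun _ hx => div_nonneg hx.1.le (sqrt_nonneg _))

lemma setIntegral_mul_ellK {c : ℝ} (hc : c ∈ Ioo (0:ℝ) 1) :
    ∫ x in Ioo (0:ℝ) 1, x / √((1 - x ^ 2) * (1 - c ^ 2 * x ^ 2)) =
      log ((1 + c) / √(1 - c ^ 2)) / c := by
  rw [← integral_Ioc_eq_integral_Ioo, ← intervalIntegral.integral_of_le zero_le_one,
    intervalIntegral.integral_eq_sub_of_hasDerivAt_of_le zero_le_one
      (continuousOn_ellK_primitive hc) (fun _ hx => hasDerivAt_ellK_primitive hc hx)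
      ((intervalIntegrable_iff_integrableOn_Ioc_of_le zero_le_one).2 (integrableOn_mul_ellK hc)),
    log_div (by linarith [hc.1]) (sqrt_pos.2 (one_sub_sq_pos hc)).ne']
  simp
  ring_nf

lemma log_div_le_ellK {c : ℝ} (hc : c ∈ Ioo (0:ℝ) 1) :
    log ((1 + c) / √(1 - c ^ 2)) / c ≤ ellK c := by
  rw [← setIntegral_mul_ellK hc, ellK_eq_setIntegral]
  refine setIntegral_mono_on ((integrableOn_mul_ellK hc).mono_set Ioo_subset_Ioc_self)
    (integrableOn_ellK hc) measurableSet_Ioo fun x hx => ?_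
  gcongr
  exact hx.2.le

lemma ellK_le_log_div_add_one {c : ℝ} (hc : c ∈ Ioo (0:ℝ) 1) :
    ellK c ≤ log ((1 + c) / √(1 - c ^ 2)) / c + 1 := by
  have hi := (integrableOn_mul_ellK hc).mono_set Ioo_subset_Ioc_self
  have h1 : IntegrableOn (fun _ : ℝ => (1:ℝ)) (Ioo 0 1) := by simp
  have h := setIntegral_mono_on (integrableOn_ellK hc) (hi.add h1) measurableSet_Ioo
    (fun x hx => ?_)
  · rw [← ellK_eq_setIntegral] at h
    simp only [Pi.add_apply] at h
    rw [integral_add hi h1, setIntegral_mul_ellK hc] at h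
    simpa using h
  · have hx1 := one_sub_sq_pos hx
    have hx2 := one_sub_sq_mul_sq_pos (Ioo_subset_Icc_self hc) hx
    have hs := sqrt_pos.2 (mul_pos hx1 hx2)
    have hle : 1 - x ≤ √((1 - x ^ 2) * (1 - c ^ 2 * x ^ 2)) := by
      refine le_sqrt_of_sq_le ?_
      have hxx : 1 - x ≤ 1 - x ^ 2 := by nlinarith [hx.1, hx.2]
      have hcx : 1 - x ^ 2 ≤ 1 - c ^ 2 * x ^ 2 := by
        nlinarith [mul_nonneg (sq_nonneg x) (one_sub_sq_pos hc).le]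
      rw [sq]
      exact mul_le_mul hxx (hxx.trans hcx) (by linarith [hx.2]) hx1.le
    simp only [Pi.add_apply]
    rw [div_add_one hs.ne', div_le_div_iff_of_pos_right hs]
    linarith

/-! ### The Landen transformation -/

lemma hasDerivAt_landen {k y : ℝ} (h : 1 + k * y ^ 2 ≠ 0) :
    HasDerivAt (fun y : ℝ => (1 + k) * y / (1 + k * y ^ 2))
      ((1 + k) * (1 - k * y ^ 2) / (1 + k * y ^ 2) ^ 2) y := by
  have d1 : HasDerivAt (fun y : ℝ => (1 + k) * y) (1 + k) y := by
    simpa using (hasDerivAt_id y).const_mul (1 + k)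
  have d2 : HasDerivAt (fun y : ℝ => 1 + k * y ^ 2) (k * (2 * y)) y := by
    simpa using ((hasDerivAt_pow 2 y).const_mul k).const_add 1
  exact (d1.div d2 h).congr_deriv (by ring)

lemma landen_lt {k x y : ℝ} (hk : k ∈ Ioo (0:ℝ) 1) (hx : 0 ≤ x) (hxy : x < y) (hy : y ≤ 1) :
    (1 + k) * x / (1 + k * x ^ 2) < (1 + k) * y / (1 + k * y ^ 2) := by
  have hk0 := hk.1
  rw [div_lt_div_iff₀ (by positivity) (by positivity)]
  have h1 : x * y < 1 := by nlinarith
  have h2 : 0 < 1 - k * (x * y) := by nlinarith [hk.2, mul_nonneg hx (hx.trans hxy.le)]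
  have h3 := mul_pos (mul_pos (by linarith : 0 < 1 + k) (sub_pos.2 hxy)) h2
  nlinarith

lemma image_landen {k : ℝ} (hk : k ∈ Ioo (0:ℝ) 1) :
    (fun y : ℝ => (1 + k) * y / (1 + k * y ^ 2)) '' Ioo 0 1 = Ioo 0 1 := by
  have hk0 := hk.1
  have h0 : (1 + k) * 0 / (1 + k * 0 ^ 2) = 0 := by simp
  have h1 : (1 + k) * 1 / (1 + k * 1 ^ 2) = 1 := by
    rw [one_pow, mul_one, mul_one, div_self (by positivity)]
  refine Subset.antisymm ?_ ?_
  · rintro _ ⟨y, hy, rfl⟩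
    exact ⟨h0.symm.trans_lt (landen_lt hk le_rfl hy.1 hy.2.le),
      (landen_lt hk hy.1.le hy.2 le_rfl).trans_eq h1⟩
  · have h := intermediate_value_Ioo (f := fun y : ℝ => (1 + k) * y / (1 + k * y ^ 2))
      zero_le_one (fun y _ => (hasDerivAt_landen
        (by positivity)).continuousAt.continuousWithinAt)
    simpa only [h0, h1] using h

/-- Landen's ascending transformation. -/
theorem ellK_landen {k : ℝ} (hk : k ∈ Ioo (0:ℝ) 1) :
    ellK (2 * √k / (1 + k)) = (1 + k) * ellK k := by
  have hk0 := hk.1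
  have hmono : StrictMonoOn (fun y : ℝ => (1 + k) * y / (1 + k * y ^ 2)) (Ioo 0 1) :=
    fun x hx y hy hxy => landen_lt hk hx.1.le hxy hy.2.le
  rw [ellK_eq_setIntegral, ellK_eq_setIntegral]
  nth_rewrite 1 [← image_landen hk]
  rw [integral_image_eq_integral_abs_deriv_smul measurableSet_Ioo
    (fun y _ => (hasDerivAt_landen (by positivity)).hasDerivWithinAt) hmono.injOn,
    ← integral_const_mul]
  refine setIntegral_congr_fun measurableSet_Ioo fun y hy => ?_
  have hp : 0 < 1 + k * y ^ 2 := by positivity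
  have hm : 0 < 1 - k * y ^ 2 := by
    have := one_sub_sq_pos hy
    nlinarith [hk.2, sq_nonneg y]
  have h1 := one_sub_sq_pos hy
  have h2 := one_sub_sq_mul_sq_pos (Ioo_subset_Icc_self hk) hy
  have hs := sqrt_pos.2 (mul_pos h1 h2)
  have key : (1 - ((1 + k) * y / (1 + k * y ^ 2)) ^ 2) *
      (1 - (2 * √k / (1 + k)) ^ 2 * ((1 + k) * y / (1 + k * y ^ 2)) ^ 2) =
      ((1 - k * y ^ 2) / (1 + k * y ^ 2) ^ 2) ^ 2 * ((1 - y ^ 2) * (1 - k ^ 2 * y ^ 2)) := by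
    rw [div_pow (2 * √k), mul_pow 2, sq_sqrt hk0.le]
    field_simp
    ring
  simp only [smul_eq_mul]
  rw [key, sqrt_mul (sq_nonneg _), sqrt_sq (by positivity), abs_of_nonneg (by positivity)]
  field_simp

/-- The modulus obtained from `r` by the descending Landen transformation. -/
noncomputable def landenDesc (r : ℝ) : ℝ := (1 - √(1 - r ^ 2)) / (1 + √(1 - r ^ 2))

lemma landenDesc_eq {r : ℝ} (hr : r ∈ Ioo (0:ℝ) 1) :
    landenDesc r = (r / (1 + √(1 - r ^ 2))) ^ 2 := by
  have h := sqrt_one_sub_sq_mem hr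
  have h2 := sq_sqrt_one_sub_sq hr
  have hp : 0 < 1 + √(1 - r ^ 2) := by linarith [h.1]
  rw [landenDesc, div_pow, div_eq_div_iff hp.ne' (by positivity)]
  linear_combination (-(1 + √(1 - r ^ 2))) * h2

lemma landenDesc_mem {r : ℝ} (hr : r ∈ Ioo (0:ℝ) 1) : landenDesc r ∈ Ioo (0:ℝ) 1 := by
  have h := sqrt_one_sub_sq_mem hr
  have hp : 0 < 1 + √(1 - r ^ 2) := by linarith [h.1]
  exact ⟨div_pos (by linarith [h.2]) hp, (div_lt_one hp).2 (by linarith [h.1])⟩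

lemma iterate_landenDesc_mem {r : ℝ} (hr : r ∈ Ioo (0:ℝ) 1) (n : ℕ) :
    landenDesc^[n] r ∈ Ioo (0:ℝ) 1 := by
  induction n with
  | zero => exact hr
  | succ n ih => rw [Function.iterate_succ_apply']; exact landenDesc_mem ih

lemma landenDesc_lt {r s : ℝ} (hr : r ∈ Ioo (0:ℝ) 1) (hs : s ∈ Ioo (0:ℝ) 1) (h : r < s) :
    landenDesc r < landenDesc s := by
  have h1 := sqrt_one_sub_sq_mem hr
  have h2 := sqrt_one_sub_sq_mem hs
  have h3 : √(1 - s ^ 2) < √(1 - r ^ 2) :=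
    sqrt_lt_sqrt (one_sub_sq_pos hs).le (by nlinarith [hr.1])
  rw [landenDesc, landenDesc, div_lt_div_iff₀ (by linarith [h1.1]) (by linarith [h2.1])]
  nlinarith

lemma iterate_landenDesc_lt {r s : ℝ} (hr : r ∈ Ioo (0:ℝ) 1) (hs : s ∈ Ioo (0:ℝ) 1)
    (h : r < s) (n : ℕ) : landenDesc^[n] r < landenDesc^[n] s := by
  induction n with
  | zero => exact h
  | succ n ih =>
    rw [Function.iterate_succ_apply', Function.iterate_succ_apply']
    exact landenDesc_lt (iterate_landenDesc_mem hr n) (iterate_landenDesc_mem hs n) ih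

lemma continuous_landenDesc : Continuous landenDesc := by
  unfold landenDesc
  exact Continuous.div (by fun_prop) (by fun_prop) fun r => by positivity

lemma landenDesc_zero : landenDesc 0 = 0 := by simp [landenDesc]

lemma landenDesc_one : landenDesc 1 = 1 := by simp [landenDesc]

theorem mu_landenDesc {r : ℝ} (hr : r ∈ Ioo (0:ℝ) 1) : mu (landenDesc r) = 2 * mu r := by
  have h := sqrt_one_sub_sq_mem hr
  have hc := sq_sqrt_one_sub_sq hr
  have hd := landenDesc_mem hr
  have h1 := ellK_landen hd
  have h2 := ellK_landen h
  have hKd := ellK_pos hd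
  have e1 : 1 + landenDesc r = 2 / (1 + √(1 - r ^ 2)) := by
    have : 0 < 1 + √(1 - r ^ 2) := by linarith [h.1]
    rw [landenDesc]
    field_simp
    ring
  have e2 : √(landenDesc r) = r / (1 + √(1 - r ^ 2)) := by
    rw [landenDesc_eq hr, sqrt_sq (div_nonneg hr.1.le (by positivity))]
  have e3 : √(1 - landenDesc r ^ 2) = 2 * √√(1 - r ^ 2) / (1 + √(1 - r ^ 2)) := by
    rw [sqrt_eq_iff_mul_self_eq (by nlinarith [hd.1, hd.2]) (by positivity), ← sq, div_pow,
      mul_pow, sq_sqrt h.1.le, landenDesc]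
    field_simp
    ring
  rw [e1, e2] at h1
  rw [← e3] at h2
  have e4 : 2 * (r / (1 + √(1 - r ^ 2))) / (2 / (1 + √(1 - r ^ 2))) = r := by
    field_simp
  rw [e4] at h1
  rw [mu, mu, h2, h1]
  have hp : 0 < 1 + √(1 - r ^ 2) := by linarith [h.1]
  field_simp

/-! ### The series for `μ(r) + log r` -/

lemma mu_add_log_nonneg {r : ℝ} (hr : r ∈ Ioo (0:ℝ) 1) : 0 ≤ mu r + log r := by
  have h := sqrt_one_sub_sq_mem hr
  have hK := ellK_pos hr
  have h1 := ellK_le hr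
  have h2 := log_div_le_ellK h
  rw [sqrt_one_sub_sqrt_sq hr, div_le_iff₀ h.1] at h2
  rw [le_div_iff₀ h.1] at h1
  have h3 : log ((1 + √(1 - r ^ 2)) / r) = log (1 + √(1 - r ^ 2)) - log r :=
    log_div (by linarith [h.1]) hr.1.ne'
  have h4 : 0 ≤ log (1 + √(1 - r ^ 2)) := log_nonneg (by linarith [h.1])
  have h5 : ellK √(1 - r ^ 2) * √(1 - r ^ 2) ≤ mu r := by
    rw [mu, le_div_iff₀ hK]
    nlinarith [ellK_pos h]
  linarith

lemma mu_add_log_le {r : ℝ} (hr : r ∈ Ioo (0:ℝ) 1) : mu r + log r ≤ 3 := by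
  have h := sqrt_one_sub_sq_mem hr
  have hsq := sq_sqrt_one_sub_sq hr
  have h2 := ellK_le_log_div_add_one h
  rw [sqrt_one_sub_sqrt_sq hr] at h2
  have h5 : mu r ≤ ellK √(1 - r ^ 2) := by
    rw [mu, div_le_iff₀ (ellK_pos hr), mul_comm]
    exact mul_le_mul_of_nonneg_left (pi_div_two_le_ellK hr) (ellK_pos h).le
  have h3 : log ((1 + √(1 - r ^ 2)) / r) = log (1 + √(1 - r ^ 2)) - log r :=
    log_div (by linarith [h.1]) hr.1.ne'
  set c := √(1 - r ^ 2)
  have hc1 : 0 < 1 - c := by linarith [h.2]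
  have hc2 : 0 < 1 + c := by linarith [h.1]
  have h4 : log (1 + c) ≤ 1 := by linarith [log_le_sub_one_of_pos hc2, h.2]
  have h6 : 2 * log ((1 + c) / r) ≤ 2 * c / (1 - c) := by
    have e : ((1 + c) / r) ^ 2 = (1 + c) / (1 - c) := by
      rw [div_pow, div_eq_div_iff (pow_pos hr.1 2).ne' hc1.ne']
      linear_combination (-(1 + c)) * hsq
    have := log_le_sub_one_of_pos (div_pos hc2 hc1)
    rw [← e, log_pow, e] at this
    push_cast at this
    refine this.trans_eq ?_
    field_simp
    ring
  have h7 : log ((1 + c) / r) / c ≤ log ((1 + c) / r) + 1 := by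
    rw [le_div_iff₀ hc1] at h6
    rw [div_le_iff₀ h.1]
    linarith
  linarith

lemma mu_add_log_eq {r : ℝ} (hr : r ∈ Ioo (0:ℝ) 1) :
    mu r + log r =
      log (1 + √(1 - r ^ 2)) + (mu (landenDesc r) + log (landenDesc r)) / 2 := by
  have h := sqrt_one_sub_sq_mem hr
  rw [mu_landenDesc hr, landenDesc_eq hr, log_pow, log_div hr.1.ne' (by linarith [h.1])]
  push_cast
  ring

/-- The `n`-th term of the series expansion of `μ(r) + log r`. -/
noncomputable def muTerm (n : ℕ) (r : ℝ) : ℝ :=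
  (1 / 2) ^ n * log (1 + √(1 - (landenDesc^[n] r) ^ 2))

lemma continuous_muTerm (n : ℕ) : Continuous (muTerm n) := by
  have := continuous_landenDesc.iterate n
  unfold muTerm
  exact continuous_const.mul (Continuous.log (by fun_prop) fun r => by positivity)

lemma norm_muTerm_le (n : ℕ) (r : ℝ) : ‖muTerm n r‖ ≤ (1 / 2) ^ n * log 2 := by
  have h0 := sqrt_nonneg (1 - (landenDesc^[n] r) ^ 2)
  have h1 : √(1 - (landenDesc^[n] r) ^ 2) ≤ 1 :=
    sqrt_le_one.2 (by nlinarith [sq_nonneg (landenDesc^[n] r)])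
  have h2 : 0 ≤ log (1 + √(1 - (landenDesc^[n] r) ^ 2)) := log_nonneg (by linarith)
  rw [muTerm, norm_of_nonneg (by positivity)]
  gcongr
  linarith

lemma summable_muTerm_bound : Summable fun n : ℕ => (1 / 2 : ℝ) ^ n * log 2 :=
  summable_geometric_two.mul_right _

lemma summable_muTerm (r : ℝ) : Summable fun n => muTerm n r :=
  summable_muTerm_bound.of_norm_bounded fun n => norm_muTerm_le n r

lemma muTerm_lt {r s : ℝ} (hr : r ∈ Ioo (0:ℝ) 1) (hs : s ∈ Ioo (0:ℝ) 1) (h : r < s) (n : ℕ) :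
    muTerm n s < muTerm n r := by
  have h1 := iterate_landenDesc_mem hr n
  have h2 := iterate_landenDesc_mem hs n
  have h3 := iterate_landenDesc_lt hr hs h n
  have h4 : √(1 - (landenDesc^[n] s) ^ 2) < √(1 - (landenDesc^[n] r) ^ 2) :=
    sqrt_lt_sqrt (one_sub_sq_pos h2).le (by nlinarith [h1.1])
  exact mul_lt_mul_of_pos_left (log_lt_log (by positivity) (by linarith)) (by positivity)

lemma mu_add_log_eq_sum {r : ℝ} (hr : r ∈ Ioo (0:ℝ) 1) (n : ℕ) :
    mu r + log r = ∑ k ∈ Finset.range n, muTerm k r +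
      (1 / 2) ^ n * (mu (landenDesc^[n] r) + log (landenDesc^[n] r)) := by
  induction n with
  | zero => simp
  | succ n ih =>
    rw [ih, Finset.sum_range_succ, Function.iterate_succ_apply',
      mu_add_log_eq (iterate_landenDesc_mem hr n), muTerm]
    ring

theorem mu_add_log_eq_tsum {r : ℝ} (hr : r ∈ Ioo (0:ℝ) 1) :
    mu r + log r = ∑' n, muTerm n r := by
  have hrem : Tendsto (fun n : ℕ => (1 / 2 : ℝ) ^ n *
      (mu (landenDesc^[n] r) + log (landenDesc^[n] r))) atTop (𝓝 0) := by
    refine squeeze_zero (g := fun n : ℕ => (1 / 2 : ℝ) ^ n * 3) (fun n => ?_) (fun n => ?_) ?_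
    · exact mul_nonneg (by positivity) (mu_add_log_nonneg (iterate_landenDesc_mem hr n))
    · exact mul_le_mul_of_nonneg_left (mu_add_log_le (iterate_landenDesc_mem hr n))
        (by positivity)
    · simpa using (tendsto_pow_atTop_nhds_zero_of_lt_one (r := (1 / 2 : ℝ)) (by norm_num)
        (by norm_num)).mul_const 3
  have h := (summable_muTerm r).hasSum.tendsto_sum_nat.add hrem
  simp only [← mu_add_log_eq_sum hr, add_zero] at h
  exact tendsto_nhds_unique tendsto_const_nhds h

lemma continuous_tsum_muTerm : Continuous fun r => ∑' n, muTerm n r :=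
  continuous_tsum continuous_muTerm summable_muTerm_bound norm_muTerm_le

lemma tsum_muTerm_zero : ∑' n, muTerm n 0 = log 4 := by
  have h (n : ℕ) : muTerm n 0 = (1 / 2) ^ n * log 2 := by
    rw [muTerm, Function.iterate_fixed landenDesc_zero]
    norm_num
  simp_rw [h]
  rw [tsum_mul_right, tsum_geometric_two, show (4 : ℝ) = 2 ^ 2 by norm_num, log_pow]
  norm_num

lemma tsum_muTerm_one : ∑' n, muTerm n 1 = 0 := by
  have h (n : ℕ) : muTerm n 1 = 0 := by
    rw [muTerm, Function.iterate_fixed landenDesc_one]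
    simp
  simp [h]

lemma strictAntiOn_mu_add_log : StrictAntiOn (fun r => mu r + log r) (Ioo (0:ℝ) 1) := by
  intro r hr s hs h
  simp only [mu_add_log_eq_tsum hr, mu_add_log_eq_tsum hs]
  exact Summable.tsum_lt_tsum (i := 0) (fun n => (muTerm_lt hr hs h n).le)
    (muTerm_lt hr hs h 0) (summable_muTerm s) (summable_muTerm r)

lemma tendsto_mu_add_log_zero :
    Tendsto (fun r => mu r + log r) (𝓝[>] 0) (𝓝 (log 4)) := by
  have h := (continuous_tsum_muTerm.tendsto 0).mono_left (nhdsWithin_le_nhds (s := Ioi 0))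
  rw [tsum_muTerm_zero] at h
  refine h.congr' ?_
  filter_upwards [Ioo_mem_nhdsGT (zero_lt_one' ℝ)] with r hr using (mu_add_log_eq_tsum hr).symm

lemma tendsto_mu_add_log_one :
    Tendsto (fun r => mu r + log r) (𝓝[<] 1) (𝓝 0) := by
  have h := (continuous_tsum_muTerm.tendsto 1).mono_left (nhdsWithin_le_nhds (s := Iio 1))
  rw [tsum_muTerm_one] at h
  refine h.congr' ?_
  filter_upwards [Ioo_mem_nhdsLT (zero_lt_one' ℝ)] with r hr using (mu_add_log_eq_tsum hr).symm

lemma image_mu_add_log :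
    (fun r => mu r + log r) '' Ioo (0:ℝ) 1 = Ioo 0 (log 4) := by
  refine Subset.antisymm ?_ ?_
  · rintro _ ⟨r, hr, rfl⟩
    constructor
    · obtain ⟨s, hs⟩ := exists_between hr.2
      have hs' : s ∈ Ioo (0:ℝ) 1 := ⟨hr.1.trans hs.1, hs.2⟩
      exact (mu_add_log_nonneg hs').trans_lt (strictAntiOn_mu_add_log hr hs' hs.1)
    · obtain ⟨s, hs⟩ := exists_between hr.1
      have hs' : s ∈ Ioo (0:ℝ) 1 := ⟨hs.1, hs.2.trans hr.2⟩
      refine (strictAntiOn_mu_add_log hs' hr hs.2).trans_le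
        (ge_of_tendsto tendsto_mu_add_log_zero ?_)
      filter_upwards [Ioo_mem_nhdsGT hs.1] with t ht
      exact (strictAntiOn_mu_add_log ⟨ht.1, ht.2.trans hs'.2⟩ hs' ht.2).le
  · have h := intermediate_value_Ioo' zero_le_one
      (continuous_tsum_muTerm.continuousOn (s := Icc 0 1))
    rw [tsum_muTerm_zero, tsum_muTerm_one] at h
    exact h.trans_eq (image_congr fun r hr => (mu_add_log_eq_tsum hr).symm)

theorem mu_add_log_strictAnti :
    StrictAntiOn (fun r => mu r + Real.log r) (Set.Ioo (0:ℝ) 1) ∧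
    Filter.Tendsto (fun r => mu r + Real.log r) (nhdsWithin 0 (Set.Ioi 0))
      (nhds (Real.log 4)) ∧
    Filter.Tendsto (fun r => mu r + Real.log r) (nhdsWithin 1 (Set.Iio 1))
      (nhds 0) ∧
    (fun r => mu r + Real.log r) '' Set.Ioo (0:ℝ) 1 = Set.Ioo 0 (Real.log 4) :=
  ⟨strictAntiOn_mu_add_log, tendsto_mu_add_log_zero, tendsto_mu_add_log_one, image_mu_add_log⟩
end

section
/- For every r ∈ (0,1) and every nonnegative integer p, 2^(-p)·log(1/L(r,-p)) < μ(r) < 2^(-p)·log(4/L(r,-p)), where L(r,-p) denotes the descending Landen sequence of r. -/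
/-- Descending Landen sequence: `descL r p = L(r,-p)`. -/
noncomputable def descL (r : ℝ) : ℕ → ℝ
  | 0 => r
  | p + 1 => (descL r p / (1 + Real.sqrt (1 - (descL r p) ^ 2))) ^ 2

/-- Ascending Landen sequence: `ascL r p = L(r,p)`. -/
noncomputable def ascL (r : ℝ) : ℕ → ℝ
  | 0 => r
  | p + 1 => 2 * Real.sqrt (ascL r p) / (1 + ascL r p)

open MeasureTheory Set Filter Topology

/-- The integral `∫₀^∞ dt / √((a² + t²)(b² + t²))`, whose value is `π / (2 AGM(a, b))`. -/
noncomputable def agmIntegral (a b : ℝ) : ℝ :=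
  ∫ t in Ioi (0 : ℝ), (√((a ^ 2 + t ^ 2) * (b ^ 2 + t ^ 2)))⁻¹

theorem ellK_eq_agmIntegral {k s : ℝ} (hs : 0 < s) (h : k ^ 2 + s ^ 2 = 1) :
    ellK k = agmIntegral 1 s := by
  have himage : (fun t : ℝ => (√(1 + t ^ 2))⁻¹) '' Ioi 0 = Ioo 0 1 := by
    ext x
    constructor
    · rintro ⟨t, ht, rfl⟩
      have ht : 0 < t := ht
      refine ⟨by positivity, inv_lt_one_of_one_lt₀ ?_⟩
      rw [Real.lt_sqrt (by norm_num)]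
      nlinarith
    · rintro ⟨h0, h1⟩
      have hx : 0 < 1 - x ^ 2 := by nlinarith
      refine ⟨√(1 - x ^ 2) / x, div_pos (Real.sqrt_pos.2 hx) h0, ?_⟩
      have : 1 + (√(1 - x ^ 2) / x) ^ 2 = (x⁻¹) ^ 2 := by
        rw [div_pow, Real.sq_sqrt hx.le]
        field_simp
        ring
      simp only [this]
      rw [Real.sqrt_sq (by positivity), inv_inv]
  have hderiv : ∀ t ∈ Ioi (0 : ℝ), HasDerivWithinAt (fun t : ℝ => (√(1 + t ^ 2))⁻¹)
      (-(t / √(1 + t ^ 2)) / (√(1 + t ^ 2)) ^ 2) (Ioi 0) t := by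
    intro t _
    have hpos : 0 < 1 + t ^ 2 := by positivity
    have h1 : HasDerivAt (fun t : ℝ => 1 + t ^ 2) (2 * t) t := by
      simpa using (hasDerivAt_pow 2 t).const_add 1
    have h2 := (h1.sqrt hpos.ne').inv (Real.sqrt_pos.2 hpos).ne'
    refine h2.hasDerivWithinAt.congr_deriv ?_
    field_simp
  have hinj : InjOn (fun t : ℝ => (√(1 + t ^ 2))⁻¹) (Ioi 0) := by
    intro x hx y hy hxy
    have hx : 0 < x := hx
    have hy : 0 < y := hy
    have h1 := inv_injective hxy
    rw [Real.sqrt_inj (by positivity) (by positivity)] at h1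
    exact (pow_left_inj₀ hx.le hy.le two_ne_zero).1 (by linarith)
  unfold ellK agmIntegral
  rw [intervalIntegral.integral_of_le zero_le_one, integral_Ioc_eq_integral_Ioo, ← himage,
    integral_image_eq_integral_abs_deriv_smul measurableSet_Ioi hderiv hinj]
  refine setIntegral_congr_fun measurableSet_Ioi fun t ht => ?_
  have ht : 0 < t := ht
  have hpos : 0 < 1 + t ^ 2 := by positivity
  set q := √(1 + t ^ 2) with hq
  have hq0 : 0 < q := Real.sqrt_pos.2 hpos
  have hq2 : q ^ 2 = 1 + t ^ 2 := Real.sq_sqrt hpos.le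
  have hst : 0 < s ^ 2 + t ^ 2 := by positivity
  have e1 : (1 - q⁻¹ ^ 2) * (1 - k ^ 2 * q⁻¹ ^ 2) = (t / q ^ 2) ^ 2 * (s ^ 2 + t ^ 2) := by
    field_simp
    rw [hq2, show k ^ 2 = 1 - s ^ 2 by linarith]
    ring
  have e2 : √((1 ^ 2 + t ^ 2) * (s ^ 2 + t ^ 2)) = q * √(s ^ 2 + t ^ 2) := by
    rw [one_pow, Real.sqrt_mul hpos.le]
  have e3 : √((t / q ^ 2) ^ 2 * (s ^ 2 + t ^ 2)) = t / q ^ 2 * √(s ^ 2 + t ^ 2) := by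
    rw [Real.sqrt_mul (by positivity), Real.sqrt_sq (by positivity)]
  have hw : 0 < √(s ^ 2 + t ^ 2) := Real.sqrt_pos.2 hst
  simp only [smul_eq_mul]
  rw [e1, e2, e3, neg_div, abs_neg, abs_of_pos (by positivity)]
  field_simp

theorem agmIntegral_mul_mul {c : ℝ} (hc : 0 < c) (a b : ℝ) :
    agmIntegral (c * a) (c * b) = agmIntegral a b / c := by
  have h := integral_comp_mul_left_Ioi
    (fun t : ℝ => (√(((c * a) ^ 2 + t ^ 2) * ((c * b) ^ 2 + t ^ 2)))⁻¹) 0 hc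
  have h2 : ∀ t : ℝ, (√(((c * a) ^ 2 + (c * t) ^ 2) * ((c * b) ^ 2 + (c * t) ^ 2)))⁻¹ =
      (c ^ 2)⁻¹ * (√((a ^ 2 + t ^ 2) * (b ^ 2 + t ^ 2)))⁻¹ := by
    intro t
    rw [show ((c * a) ^ 2 + (c * t) ^ 2) * ((c * b) ^ 2 + (c * t) ^ 2) =
      (c ^ 2) ^ 2 * ((a ^ 2 + t ^ 2) * (b ^ 2 + t ^ 2)) by ring,
      Real.sqrt_mul (by positivity), Real.sqrt_sq (by positivity), mul_inv]
  simp only [h2, integral_const_mul, mul_zero, smul_eq_mul] at h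
  unfold agmIntegral
  field_simp at h ⊢
  linarith

/-- Invariance of the integral under one step of the arithmetic-geometric mean iteration. -/
theorem agmIntegral_eq_of_mean {a b m g : ℝ} (ha : 0 < a) (hb : 0 < b) (hm : 2 * m = a + b)
    (hg : g ^ 2 = a * b) : agmIntegral a b = agmIntegral m g := by
  have hab : 0 < a * b := mul_pos ha hb
  have himage : (fun t : ℝ => (t - a * b / t) / 2) '' Ioi 0 = univ := by
    refine eq_univ_of_forall fun u => ?_
    have hlt : |u| < √(u ^ 2 + a * b) := by
      rw [← Real.sqrt_sq_eq_abs]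
      exact Real.sqrt_lt_sqrt (sq_nonneg u) (by linarith)
    have hpos : 0 < u + √(u ^ 2 + a * b) := by linarith [neg_abs_le u]
    refine ⟨u + √(u ^ 2 + a * b), hpos, ?_⟩
    have hsq : √(u ^ 2 + a * b) ^ 2 = u ^ 2 + a * b := Real.sq_sqrt (by positivity)
    simp only
    field_simp
    nlinarith
  have hderiv : ∀ t ∈ Ioi (0 : ℝ), HasDerivWithinAt (fun t : ℝ => (t - a * b / t) / 2)
      ((1 + a * b / t ^ 2) / 2) (Ioi 0) t := by
    intro t ht
    have ht : 0 < t := ht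
    have h1 := ((hasDerivAt_id t).sub ((hasDerivAt_inv ht.ne').const_mul (a * b))).div_const 2
    refine h1.hasDerivWithinAt.congr_deriv ?_
    field_simp
    ring
  have hinj : InjOn (fun t : ℝ => (t - a * b / t) / 2) (Ioi 0) := by
    intro x hx y hy hxy
    have hx : 0 < x := hx
    have hy : 0 < y := hy
    have hxy : (x - a * b / x) / 2 = (y - a * b / y) / 2 := hxy
    field_simp at hxy
    have h0 : (x - y) * (x * y + a * b) = 0 := by linarith
    rcases mul_eq_zero.1 h0 with h | h
    · linarith
    · nlinarith [mul_pos hx hy]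
  have key := integral_image_eq_integral_abs_deriv_smul measurableSet_Ioi hderiv hinj
    (fun u => (√((m ^ 2 + u ^ 2) * (g ^ 2 + u ^ 2)))⁻¹)
  have heven := integral_comp_abs (f := fun u : ℝ => (√((m ^ 2 + u ^ 2) * (g ^ 2 + u ^ 2)))⁻¹)
  simp only [sq_abs] at heven
  rw [himage, setIntegral_univ, heven] at key
  have hR : ∫ t in Ioi (0 : ℝ), |(1 + a * b / t ^ 2) / 2| •
      (√((m ^ 2 + ((t - a * b / t) / 2) ^ 2) * (g ^ 2 + ((t - a * b / t) / 2) ^ 2)))⁻¹ =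
      2 * agmIntegral a b := by
    unfold agmIntegral
    rw [← integral_const_mul]
    refine setIntegral_congr_fun measurableSet_Ioi fun t ht => ?_
    have ht : 0 < t := ht
    have e : (m ^ 2 + ((t - a * b / t) / 2) ^ 2) * (g ^ 2 + ((t - a * b / t) / 2) ^ 2) =
        ((t ^ 2 + a * b) / (4 * t ^ 2)) ^ 2 * ((a ^ 2 + t ^ 2) * (b ^ 2 + t ^ 2)) := by
      rw [hg, show m = (a + b) / 2 by linarith]
      field_simp
      ring
    have hw : 0 < √((a ^ 2 + t ^ 2) * (b ^ 2 + t ^ 2)) := Real.sqrt_pos.2 (by positivity)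
    simp only [smul_eq_mul]
    rw [e, Real.sqrt_mul (by positivity), Real.sqrt_sq (by positivity),
      abs_of_pos (by positivity)]
    field_simp
    ring
  rw [hR] at key
  unfold agmIntegral at key ⊢
  linarith

theorem mu_eq_agmIntegral {r s : ℝ} (hr : 0 < r) (hs : 0 < s) (h : r ^ 2 + s ^ 2 = 1) :
    mu r = Real.pi / 2 * agmIntegral 1 r / agmIntegral 1 s := by
  unfold mu
  rw [show 1 - r ^ 2 = s ^ 2 by linarith, Real.sqrt_sq hs.le,
    ellK_eq_agmIntegral (k := s) hr (by linarith), ellK_eq_agmIntegral hs h]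

theorem integrableOn_agmIntegrand {a b : ℝ} (ha : 0 < a) (hb : 0 < b) :
    IntegrableOn (fun t : ℝ => (√((a ^ 2 + t ^ 2) * (b ^ 2 + t ^ 2)))⁻¹) (Ioi 0) := by
  obtain ⟨c, hc, hca, hcb, hc1⟩ : ∃ c : ℝ, 0 < c ∧ c ≤ a ∧ c ≤ b ∧ c ≤ 1 :=
    ⟨min (min a b) 1, by positivity, (min_le_left _ _).trans (min_le_left _ _),
      (min_le_left _ _).trans (min_le_right _ _), min_le_right _ _⟩
  refine Integrable.mono' ((integrable_inv_one_add_sq.const_mul (c ^ 2)⁻¹).integrableOn)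
    ?_ (Eventually.of_forall fun t => ?_)
  · exact Measurable.aestronglyMeasurable (by fun_prop)
  · rw [Real.norm_of_nonneg (by positivity), ← mul_inv]
    refine inv_anti₀ (by positivity) (Real.le_sqrt_of_sq_le ?_)
    have h1 : c ^ 2 * (1 + t ^ 2) ≤ a ^ 2 + t ^ 2 := by
      nlinarith [pow_le_pow_left₀ hc.le hca 2, pow_le_one₀ (n := 2) hc.le hc1, sq_nonneg t]
    have h2 : c ^ 2 * (1 + t ^ 2) ≤ b ^ 2 + t ^ 2 := by
      nlinarith [pow_le_pow_left₀ hc.le hcb 2, pow_le_one₀ (n := 2) hc.le hc1, sq_nonneg t]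
    rw [pow_two]
    exact mul_le_mul h1 h2 (by positivity) (by positivity)

theorem pi_div_two_le_agmIntegral {s : ℝ} (hs : 0 < s) (hs1 : s ≤ 1) :
    Real.pi / 2 ≤ agmIntegral 1 s := by
  have h : ∫ t in Ioi (0 : ℝ), (1 + t ^ 2)⁻¹ = Real.pi / 2 := by simp
  rw [← h]
  refine setIntegral_mono_on integrable_inv_one_add_sq.integrableOn
    (integrableOn_agmIntegrand one_pos hs) measurableSet_Ioi fun t ht => ?_
  have ht : 0 < t := ht
  refine inv_anti₀ (Real.sqrt_pos.2 (by positivity)) (Real.sqrt_le_iff.2 ⟨by positivity, ?_⟩)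
  rw [one_pow, pow_two (1 + t ^ 2)]
  gcongr
  nlinarith

theorem agmIntegral_le_pi_div {s : ℝ} (hs : 0 < s) (hs1 : s ≤ 1) :
    agmIntegral 1 s ≤ Real.pi / 2 / s := by
  have h : ∫ t in Ioi (0 : ℝ), s⁻¹ * (1 + t ^ 2)⁻¹ = Real.pi / 2 / s := by
    rw [integral_const_mul, integral_Ioi_inv_one_add_sq]
    simp
    ring
  rw [← h]
  refine setIntegral_mono_on (integrableOn_agmIntegrand one_pos hs)
    (integrable_inv_one_add_sq.const_mul s⁻¹).integrableOn measurableSet_Ioi fun t ht => ?_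
  have ht : 0 < t := ht
  rw [← mul_inv]
  refine inv_anti₀ (by positivity) (Real.le_sqrt_of_sq_le ?_)
  rw [one_pow, mul_pow, pow_two (1 + t ^ 2), mul_left_comm]
  gcongr
  nlinarith [pow_le_one₀ (n := 2) hs.le hs1, sq_nonneg t]

theorem log_inv_le_agmIntegral {r : ℝ} (hr : 0 < r) (hr1 : r < 1) :
    Real.log r⁻¹ ≤ agmIntegral 1 r := by
  have hderiv : ∀ t ∈ Ici (0 : ℝ), HasDerivAt
      (fun t : ℝ => Real.log ((r + t) / (1 + t))) ((1 - r) / ((r + t) * (1 + t))) t := by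
    intro t ht
    have ht : 0 ≤ t := ht
    have h1 : HasDerivAt (fun t : ℝ => (r + t) / (1 + t)) _ t :=
      ((hasDerivAt_id t).const_add r).div ((hasDerivAt_id t).const_add 1) (by simp; positivity)
    convert h1.log (by positivity) using 1
    simp only [id]
    field_simp
    ring
  have hnonneg : ∀ t ∈ Ioi (0 : ℝ), 0 ≤ (1 - r) / ((r + t) * (1 + t)) := by
    intro t ht
    have ht : 0 < t := ht
    have : 0 < 1 - r := by linarith
    positivity
  have hlim : Tendsto (fun t : ℝ => Real.log ((r + t) / (1 + t))) atTop (𝓝 0) := by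
    have h1 : Tendsto (fun t : ℝ => 1 - (1 - r) / (1 + t)) atTop (𝓝 (1 - 0)) :=
      tendsto_const_nhds.sub
        (tendsto_const_nhds.div_atTop (tendsto_atTop_add_const_left _ 1 tendsto_id))
    rw [sub_zero] at h1
    have h2 := h1.log one_ne_zero
    rw [Real.log_one] at h2
    refine h2.congr' ?_
    filter_upwards [eventually_gt_atTop 0] with t ht
    congr 1
    field_simp
    ring
  have hval := integral_Ioi_of_hasDerivAt_of_nonneg' hderiv hnonneg hlim
  have hint := integrableOn_Ioi_deriv_of_nonneg' hderiv hnonneg hlim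
  simp only [add_zero, div_one, zero_sub, ← Real.log_inv] at hval
  rw [← hval]
  refine setIntegral_mono_on hint (integrableOn_agmIntegrand one_pos hr) measurableSet_Ioi
    fun t ht => ?_
  have ht : 0 < t := ht
  have hle : √((1 ^ 2 + t ^ 2) * (r ^ 2 + t ^ 2)) ≤ (r + t) * (1 + t) := by
    refine Real.sqrt_le_iff.2 ⟨by positivity, ?_⟩
    rw [mul_pow, mul_comm]
    gcongr <;> nlinarith
  calc (1 - r) / ((r + t) * (1 + t)) ≤ 1 / ((r + t) * (1 + t)) := by gcongr; linarith
    _ ≤ _ := by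
      rw [one_div]
      exact inv_anti₀ (Real.sqrt_pos.2 (by positivity)) hle

theorem agmIntegral_le_log_inv_add {r : ℝ} (hr : 0 < r) (hr1 : r < 1) :
    agmIntegral 1 r ≤ Real.log r⁻¹ + (Real.log 3 + Real.pi) := by
  have hint := integrableOn_agmIntegrand one_pos hr
  have hsplit : agmIntegral 1 r =
      (∫ t in Ioc (0 : ℝ) 1, (√((1 ^ 2 + t ^ 2) * (r ^ 2 + t ^ 2)))⁻¹) +
      ∫ t in Ioi (1 : ℝ), (√((1 ^ 2 + t ^ 2) * (r ^ 2 + t ^ 2)))⁻¹ := by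
    unfold agmIntegral
    rw [← Ioc_union_Ioi_eq_Ioi (zero_le_one (α := ℝ))]
    exact setIntegral_union Ioc_disjoint_Ioi_same measurableSet_Ioi
      (hint.mono_set Ioc_subset_Ioi_self) (hint.mono_set (Ioi_subset_Ioi zero_le_one))
  have hcont : Continuous fun t : ℝ => (√(r ^ 2 + t ^ 2))⁻¹ :=
    Continuous.inv₀ (by fun_prop) fun t => (Real.sqrt_pos.2 (by positivity)).ne'
  have hnear : ∫ t in Ioc (0 : ℝ) 1, (√((1 ^ 2 + t ^ 2) * (r ^ 2 + t ^ 2)))⁻¹ ≤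
      Real.log r⁻¹ + Real.log 3 := by
    have hderiv : ∀ t ∈ uIcc (0 : ℝ) 1, HasDerivAt
        (fun t : ℝ => Real.log (t + √(r ^ 2 + t ^ 2))) (√(r ^ 2 + t ^ 2))⁻¹ t := by
      intro t ht
      rw [uIcc_of_le zero_le_one] at ht
      have ht0 : 0 ≤ t := ht.1
      have hpos : 0 < r ^ 2 + t ^ 2 := by positivity
      have hw : 0 < √(r ^ 2 + t ^ 2) := Real.sqrt_pos.2 hpos
      have h1 : HasDerivAt (fun t : ℝ => r ^ 2 + t ^ 2) (2 * t) t := by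
        simpa using (hasDerivAt_pow 2 t).const_add (r ^ 2)
      have h2 := ((hasDerivAt_id t).add (h1.sqrt hpos.ne')).log
        (by simp only [Pi.add_apply, id]; positivity)
      refine h2.congr_deriv ?_
      rw [Pi.add_apply, id]
      field_simp
      ring
    have hval := intervalIntegral.integral_eq_sub_of_hasDerivAt hderiv
      (hcont.intervalIntegrable 0 1)
    rw [intervalIntegral.integral_of_le zero_le_one] at hval
    have hle3 : √(r ^ 2 + 1 ^ 2) ≤ 2 := Real.sqrt_le_iff.2 ⟨by norm_num, by nlinarith⟩
    have hlog : Real.log (1 + √(r ^ 2 + 1 ^ 2)) ≤ Real.log 3 :=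
      Real.log_le_log (by positivity) (by linarith)
    have h0 : Real.log (0 + √(r ^ 2 + 0 ^ 2)) = Real.log r := by
      rw [zero_add, zero_pow two_ne_zero, add_zero, Real.sqrt_sq hr.le]
    rw [h0] at hval
    rw [Real.log_inv]
    calc _ ≤ ∫ t in Ioc (0 : ℝ) 1, (√(r ^ 2 + t ^ 2))⁻¹ := by
          refine setIntegral_mono_on (hint.mono_set Ioc_subset_Ioi_self)
            (hcont.integrableOn_Ioc) measurableSet_Ioc fun t _ => ?_
          refine inv_anti₀ (Real.sqrt_pos.2 (by positivity)) (Real.sqrt_le_sqrt ?_)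
          nlinarith [mul_nonneg (sq_nonneg t) (add_nonneg (sq_nonneg r) (sq_nonneg t))]
      _ ≤ _ := by rw [hval]; linarith
  have hfar : ∫ t in Ioi (1 : ℝ), (√((1 ^ 2 + t ^ 2) * (r ^ 2 + t ^ 2)))⁻¹ ≤ Real.pi := by
    have hint2 : IntegrableOn (fun t : ℝ => 2 * (1 + t ^ 2)⁻¹) (Ioi 0) :=
      (integrable_inv_one_add_sq.const_mul 2).integrableOn
    calc _ ≤ ∫ t in Ioi (1 : ℝ), 2 * (1 + t ^ 2)⁻¹ := by
          refine setIntegral_mono_on (hint.mono_set (Ioi_subset_Ioi zero_le_one))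
            (hint2.mono_set (Ioi_subset_Ioi zero_le_one)) measurableSet_Ioi fun t ht => ?_
          have ht : 1 < t := ht
          rw [show 2 * (1 + t ^ 2)⁻¹ = ((1 + t ^ 2) / 2)⁻¹ by rw [inv_div]; ring]
          refine inv_anti₀ (by positivity) (Real.le_sqrt_of_sq_le ?_)
          nlinarith [mul_nonneg (sq_nonneg t) (sq_nonneg r), sq_nonneg r]
      _ ≤ ∫ t in Ioi (0 : ℝ), 2 * (1 + t ^ 2)⁻¹ :=
          setIntegral_mono_set hint2 (Eventually.of_forall fun t => by positivity)
            (Ioi_subset_Ioi zero_le_one).eventuallyLE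
      _ = Real.pi := by
          rw [integral_const_mul, integral_Ioi_inv_one_add_sq]
          simp
          ring
  rw [hsplit]
  linarith

theorem sqrt_one_sub_sq_mem_Ioo {r : ℝ} (hr : r ∈ Ioo (0 : ℝ) 1) :
    √(1 - r ^ 2) ∈ Ioo (0 : ℝ) 1 := by
  obtain ⟨h0, h1⟩ := hr
  refine ⟨Real.sqrt_pos.2 (by nlinarith), ?_⟩
  rw [Real.sqrt_lt' one_pos]
  nlinarith

theorem sq_add_sq_sqrt_one_sub_sq {r : ℝ} (hr : r ∈ Ioo (0 : ℝ) 1) :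
    r ^ 2 + √(1 - r ^ 2) ^ 2 = 1 := by
  rw [Real.sq_sqrt (by nlinarith [hr.1, hr.2])]
  ring

theorem landen_mem_Ioo {r : ℝ} (hr : r ∈ Ioo (0 : ℝ) 1) :
    (r / (1 + √(1 - r ^ 2))) ^ 2 ∈ Ioo (0 : ℝ) 1 := by
  have hs := (sqrt_one_sub_sq_mem_Ioo hr).1
  have hr0 := hr.1
  refine ⟨by positivity, pow_lt_one₀ (by positivity) ?_ two_ne_zero⟩
  rw [div_lt_one (by positivity)]
  linarith [hr.2]

theorem mu_landen {r : ℝ} (hr : r ∈ Ioo (0 : ℝ) 1) :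
    mu ((r / (1 + √(1 - r ^ 2))) ^ 2) = 2 * mu r := by
  have hrs := sq_add_sq_sqrt_one_sub_sq hr
  have hd := landen_mem_Ioo hr
  obtain ⟨hs0, hs1⟩ := sqrt_one_sub_sq_mem_Ioo hr
  obtain ⟨hr0, hr1⟩ := hr
  set s := √(1 - r ^ 2)
  have hdeq : (1 + s) * (r / (1 + s)) ^ 2 = 1 - s := by
    field_simp
    linarith
  set d := (r / (1 + s)) ^ 2
  have hw : √s ^ 2 = s := Real.sq_sqrt hs0.le
  have hw0 : 0 < √s := Real.sqrt_pos.2 hs0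
  have hcompl : d ^ 2 + (2 * √s / (1 + s)) ^ 2 = 1 := by
    rw [show d = (1 - s) / (1 + s) by rw [← hdeq]; field_simp]
    field_simp
    rw [hw]
    ring
  have e1 : agmIntegral 1 d = (1 + s) * agmIntegral 1 r := by
    have h1 := agmIntegral_mul_mul (c := 1 + s) (by positivity) 1 d
    rw [hdeq, mul_one, agmIntegral_eq_of_mean (m := 1) (g := r) (by positivity) (by linarith)
      (by ring) (by linarith)] at h1
    rw [h1]
    field_simp
  have e2 : agmIntegral 1 (2 * √s / (1 + s)) = (1 + s) / 2 * agmIntegral 1 s := by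
    have h1 := agmIntegral_mul_mul (c := (1 + s) / 2) (by positivity) 1 (2 * √s / (1 + s))
    rw [show (1 + s) / 2 * (2 * √s / (1 + s)) = √s by field_simp, mul_one,
      ← agmIntegral_eq_of_mean (a := 1) (b := s) one_pos hs0 (by ring) (by linarith)] at h1
    rw [h1]
    field_simp
  have hpos : 0 < agmIntegral 1 s :=
    lt_of_lt_of_le (by positivity) (pi_div_two_le_agmIntegral hs0 hs1.le)
  rw [mu_eq_agmIntegral hd.1 (by positivity) hcompl, mu_eq_agmIntegral hr0 hs0 hrs, e1, e2]
  field_simp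

theorem log_inv_sub_one_le_mu {r : ℝ} (hr : r ∈ Ioo (0 : ℝ) 1) : Real.log r⁻¹ - 1 ≤ mu r := by
  have hrs := sq_add_sq_sqrt_one_sub_sq hr
  obtain ⟨hs0, hs1⟩ := sqrt_one_sub_sq_mem_Ioo hr
  obtain ⟨hr0, hr1⟩ := hr
  set s := √(1 - r ^ 2)
  have hK := pi_div_two_le_agmIntegral hs0 hs1.le
  have hK' := agmIntegral_le_pi_div hs0 hs1.le
  have hI := log_inv_le_agmIntegral hr0 hr1
  have hlog0 : 0 ≤ Real.log r⁻¹ := Real.log_nonneg (one_le_inv₀ hr0 |>.2 hr1.le)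
  have hlog1 : r * Real.log r⁻¹ ≤ 1 := by
    have := Real.log_le_sub_one_of_pos (inv_pos.2 hr0)
    have h2 : r * Real.log r⁻¹ ≤ r * (r⁻¹ - 1) := by gcongr
    rw [mul_sub, mul_inv_cancel₀ hr0.ne'] at h2
    linarith
  have hmu : s * Real.log r⁻¹ ≤ mu r := by
    have hpi := Real.pi_pos
    rw [mu_eq_agmIntegral hr0 hs0 hrs, le_div_iff₀ (by linarith)]
    calc s * Real.log r⁻¹ * agmIntegral 1 s ≤ s * Real.log r⁻¹ * (Real.pi / 2 / s) := by gcongr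
      _ = Real.pi / 2 * Real.log r⁻¹ := by field_simp
      _ ≤ _ := by gcongr
  have : 1 - s ≤ r := by nlinarith
  nlinarith

theorem mu_le_log_inv_add {r : ℝ} (hr : r ∈ Ioo (0 : ℝ) 1) :
    mu r ≤ Real.log r⁻¹ + (Real.log 3 + Real.pi) := by
  have hrs := sq_add_sq_sqrt_one_sub_sq hr
  obtain ⟨hs0, hs1⟩ := sqrt_one_sub_sq_mem_Ioo hr
  have hK := pi_div_two_le_agmIntegral hs0 hs1.le
  have hI := agmIntegral_le_log_inv_add hr.1 hr.2
  have hI0 := pi_div_two_le_agmIntegral hr.1 hr.2.le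
  have hpi := Real.pi_pos
  refine le_trans ?_ hI
  rw [mu_eq_agmIntegral hr.1 hs0 hrs, div_le_iff₀ (by linarith), mul_comm]
  exact mul_le_mul_of_nonneg_left hK (by linarith)

theorem pos_of_landen_lt_two_mul {f : ℝ → ℝ} {C : ℝ}
    (hstep : ∀ r ∈ Ioo (0 : ℝ) 1, f ((r / (1 + √(1 - r ^ 2))) ^ 2) < 2 * f r)
    (hbdd : ∀ r ∈ Ioo (0 : ℝ) 1, -C ≤ f r) {r : ℝ} (hr : r ∈ Ioo (0 : ℝ) 1) : 0 < f r := by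
  have hn : ∀ n : ℕ, ∀ x ∈ Ioo (0 : ℝ) 1, -C * (1 / 2) ^ n ≤ f x := by
    intro n
    induction n with
    | zero => simpa using hbdd
    | succ n ih =>
      intro x hx
      have h1 := ih _ (landen_mem_Ioo hx)
      have h2 := hstep x hx
      rw [pow_succ]
      linarith
  have hnonneg : ∀ x ∈ Ioo (0 : ℝ) 1, 0 ≤ f x := by
    intro x hx
    have hlim : Tendsto (fun n : ℕ => -C * (1 / 2 : ℝ) ^ n) atTop (𝓝 (-C * 0)) :=
      (tendsto_pow_atTop_nhds_zero_of_lt_one (by norm_num) (by norm_num)).const_mul _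
    rw [mul_zero] at hlim
    exact le_of_tendsto' hlim fun n => hn n x hx
  linarith [hnonneg _ (landen_mem_Ioo hr), hstep r hr]

theorem log_inv_landen {r : ℝ} (hr : r ∈ Ioo (0 : ℝ) 1) :
    Real.log ((r / (1 + √(1 - r ^ 2))) ^ 2)⁻¹ =
      2 * Real.log r⁻¹ + 2 * Real.log (1 + √(1 - r ^ 2)) := by
  have hs := (sqrt_one_sub_sq_mem_Ioo hr).1
  rw [Real.log_inv, Real.log_pow, Real.log_div hr.1.ne' (by positivity), Real.log_inv]
  push_cast
  ring

theorem log_inv_lt_mu {r : ℝ} (hr : r ∈ Ioo (0 : ℝ) 1) : Real.log r⁻¹ < mu r := by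
  refine sub_pos.1 (pos_of_landen_lt_two_mul (f := fun x => mu x - Real.log x⁻¹) (C := 1)
    (fun x hx => ?_) (fun x hx => ?_) hr)
  · simp only [mu_landen hx, log_inv_landen hx]
    have := Real.log_pos (show 1 < 1 + √(1 - x ^ 2) by linarith [(sqrt_one_sub_sq_mem_Ioo hx).1])
    linarith
  · linarith [log_inv_sub_one_le_mu hx]

theorem mu_lt_log_four_add_log_inv {r : ℝ} (hr : r ∈ Ioo (0 : ℝ) 1) :
    mu r < Real.log 4 + Real.log r⁻¹ := by
  have h4 : Real.log 4 = 2 * Real.log 2 := by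
    rw [show (4 : ℝ) = 2 ^ 2 by norm_num, Real.log_pow]
    norm_num
  refine sub_pos.1 (pos_of_landen_lt_two_mul
    (f := fun x => Real.log 4 + Real.log x⁻¹ - mu x) (C := Real.log 3 + Real.pi)
    (fun x hx => ?_) (fun x hx => ?_) hr)
  · simp only [mu_landen hx, log_inv_landen hx]
    obtain ⟨hs0, hs1⟩ := sqrt_one_sub_sq_mem_Ioo hx
    have := Real.log_lt_log (show 0 < 1 + √(1 - x ^ 2) by positivity)
      (show 1 + √(1 - x ^ 2) < 2 by linarith)
    linarith
  · linarith [mu_le_log_inv_add hx, Real.log_pos (show (1 : ℝ) < 4 by norm_num)]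

theorem descL_mem_Ioo {r : ℝ} (hr : r ∈ Ioo (0 : ℝ) 1) (p : ℕ) : descL r p ∈ Ioo (0 : ℝ) 1 := by
  induction p with
  | zero => exact hr
  | succ p ih => exact landen_mem_Ioo ih

theorem mu_descL {r : ℝ} (hr : r ∈ Ioo (0 : ℝ) 1) (p : ℕ) : mu (descL r p) = 2 ^ p * mu r := by
  induction p with
  | zero => simp [descL]
  | succ p ih =>
    rw [descL, mu_landen (descL_mem_Ioo hr p), ih]
    ring

theorem mu_descL_bounds (r : ℝ) (hr : r ∈ Set.Ioo (0:ℝ) 1) (p : ℕ) :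
    (2:ℝ) ^ (-(p:ℤ)) * Real.log (1 / descL r p) < mu r ∧
      mu r < (2:ℝ) ^ (-(p:ℤ)) * Real.log (4 / descL r p) := by
  have hd := descL_mem_Ioo hr p
  have hlow := log_inv_lt_mu hd
  have hupp := mu_lt_log_four_add_log_inv hd
  rw [mu_descL hr p] at hlow hupp
  have h2 : (0 : ℝ) < 2 ^ p := by positivity
  rw [zpow_neg, zpow_natCast, one_div, inv_mul_lt_iff₀ h2, lt_inv_mul_iff₀ h2, div_eq_mul_inv,
    Real.log_mul (by norm_num) (inv_pos.2 hd.1).ne']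
  exact ⟨hlow, hupp⟩
end
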